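/- arXiv:math/0610171 — 3 statements merged into one kernel-verified Lean document; each statement's English description precedes it below -/
import Mathlib

section
/- Let A be an Arens regular Banach algebra. If H^1(A**, I**) = {0} for every closed two-sided ideal I of A** (where A** carries the first Arens product), then A is 2-ideally amenable, i.e., H^1(A, I^(2)) = {0} for every closed two-sided ideal I of A. -/
/- ## Core definitions: Banach bimodules over (non-unital) complex Banach algebras,
iterated dual modules, derivations, ideal amenability, and Arens extensions. -/

noncomputable section

open ContinuousLinearMap

universe u

/-- The topological dual of a complex normed space. -/
abbrev Dl (X : Type u) [SeminormedAddCommGroup X] [NormedSpace ℂ X] : Type u := X →L[ℂ] ℂ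

/-- The canonical embedding of a normed space into its double dual. -/
def inclDD (X : Type u) [SeminormedAddCommGroup X] [NormedSpace ℂ X] : X →L[ℂ] Dl (Dl X) :=
  ContinuousLinearMap.apply ℂ ℂ

@[simp] lemma inclDD_apply {X : Type u} [SeminormedAddCommGroup X] [NormedSpace ℂ X]
    (x : X) (f : Dl X) : inclDD X x f = f x := rfl

/-- A (bounded) Banach bimodule structure of a complex Banach algebra `A`
on a complex Banach space `X`:  `l a x = a • x` and `r a x = x • a`. -/
structure Bimodule (A : Type u) [NonUnitalNormedRing A] [NormedSpace ℂ A]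
    [SMulCommClass ℂ A A] [IsScalarTower ℂ A A]
    (X : Type u) [NormedAddCommGroup X] [NormedSpace ℂ X] : Type u where
  l : A →L[ℂ] X →L[ℂ] X
  r : A →L[ℂ] X →L[ℂ] X
  l_mul : ∀ a b x, l (a * b) x = l a (l b x)
  r_mul : ∀ a b x, r (a * b) x = r b (r a x)
  lr : ∀ a b x, l a (r b x) = r b (l a x)

variable {A : Type u} [NonUnitalNormedRing A] [NormedSpace ℂ A]
  [SMulCommClass ℂ A A] [IsScalarTower ℂ A A]

/-- The dual module of a Banach bimodule: `(a·f)(x) = f(x·a)` and `(f·a)(x) = f(a·x)`. -/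
def Bimodule.dualMod {X : Type u} [NormedAddCommGroup X] [NormedSpace ℂ X]
    (M : Bimodule A X) : Bimodule A (Dl X) where
  l := ((ContinuousLinearMap.compL ℂ X X ℂ).flip).comp M.r
  r := ((ContinuousLinearMap.compL ℂ X X ℂ).flip).comp M.l
  l_mul := fun a b f => by
    ext x
    simp [M.r_mul]
  r_mul := fun a b f => by
    ext x
    simp [M.l_mul]
  lr := fun a b f => by
    ext x
    simp [M.lr]

@[simp] lemma Bimodule.dualMod_l_apply {X : Type u} [NormedAddCommGroup X] [NormedSpace ℂ X]
    (M : Bimodule A X) (a : A) (f : Dl X) (x : X) :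
    M.dualMod.l a f x = f (M.r a x) := by
  simp [Bimodule.dualMod]

@[simp] lemma Bimodule.dualMod_r_apply {X : Type u} [NormedAddCommGroup X] [NormedSpace ℂ X]
    (M : Bimodule A X) (a : A) (f : Dl X) (x : X) :
    M.dualMod.r a f x = f (M.l a x) := by
  simp [Bimodule.dualMod]

/-- A Banach `A`-bimodule, bundled with its underlying space. -/
structure BMod (A : Type u) [NonUnitalNormedRing A] [NormedSpace ℂ A]
    [SMulCommClass ℂ A A] [IsScalarTower ℂ A A] : Type (u + 1) where
  X : Type u
  [xGroup : NormedAddCommGroup X]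
  [xSpace : NormedSpace ℂ X]
  act : Bimodule A X

attribute [instance] BMod.xGroup BMod.xSpace

/-- The dual of a bundled Banach bimodule. -/
def BMod.dualObj (M : BMod A) : BMod A :=
  ⟨Dl M.X, M.act.dualMod⟩

/-- The `n`-th dual of a bundled Banach bimodule (`iter 0 = M`). -/
def BMod.iter (M : BMod A) : ℕ → BMod A
  | 0 => M
  | n + 1 => (M.iter n).dualObj

/-- A bounded derivation from `A` into the Banach `A`-bimodule `M`. -/
def IsDerivation (M : BMod A) (D : A →L[ℂ] M.X) : Prop :=
  ∀ a b : A, D (a * b) = M.act.l a (D b) + M.act.r b (D a)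

/-- An inner derivation.  -/
def IsInner (M : BMod A) (D : A →L[ℂ] M.X) : Prop :=
  ∃ x : M.X, ∀ a : A, D a = M.act.l a x - M.act.r a x

/-- `H¹(A, M) = {0}` : every bounded derivation into `M` is inner. -/
def H1Zero (M : BMod A) : Prop :=
  ∀ D : A →L[ℂ] M.X, IsDerivation M D → IsInner M D

/-- A closed two-sided ideal of the Banach algebra `A`. -/
structure ClosedIdeal (A : Type u) [NonUnitalNormedRing A] [NormedSpace ℂ A]
    [SMulCommClass ℂ A A] [IsScalarTower ℂ A A] : Type u where
  car : Submodule ℂ A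
  isClosed : IsClosed (car : Set A)
  mul_mem_left : ∀ (a x : A), x ∈ car → a * x ∈ car
  mul_mem_right : ∀ (a x : A), x ∈ car → x * a ∈ car

namespace ClosedIdeal

variable (I : ClosedIdeal A)

/-- Left multiplication action of `A` on a closed two-sided ideal. -/
def lAct : A →L[ℂ] ↥I.car →L[ℂ] ↥I.car :=
  LinearMap.mkContinuous₂
    (LinearMap.mk₂ ℂ
      (fun a x => (⟨a * (x : A), I.mul_mem_left a x x.2⟩ : ↥I.car))
      (fun a b x => Subtype.ext <| by simp [add_mul])
      (fun c a x => Subtype.ext <| by simp [smul_mul_assoc])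
      (fun a x y => Subtype.ext <| by simp [mul_add])
      (fun c a x => Subtype.ext <| by simp [mul_smul_comm]))
    1
    (fun a x => by
      simp only [LinearMap.mk₂_apply, one_mul]
      calc ‖(⟨a * (x : A), I.mul_mem_left a x x.2⟩ : ↥I.car)‖ = ‖a * (x : A)‖ := rfl
        _ ≤ ‖a‖ * ‖(x : A)‖ := norm_mul_le _ _
        _ = ‖a‖ * ‖x‖ := by rw [Submodule.coe_norm])

/-- Right multiplication action of `A` on a closed two-sided ideal. -/
def rAct : A →L[ℂ] ↥I.car →L[ℂ] ↥I.car :=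
  LinearMap.mkContinuous₂
    (LinearMap.mk₂ ℂ
      (fun a x => (⟨(x : A) * a, I.mul_mem_right a x x.2⟩ : ↥I.car))
      (fun a b x => Subtype.ext <| by simp [mul_add])
      (fun c a x => Subtype.ext <| by simp [mul_smul_comm])
      (fun a x y => Subtype.ext <| by simp [add_mul])
      (fun c a x => Subtype.ext <| by simp [smul_mul_assoc]))
    1
    (fun a x => by
      simp only [LinearMap.mk₂_apply, one_mul]
      calc ‖(⟨(x : A) * a, I.mul_mem_right a x x.2⟩ : ↥I.car)‖ = ‖(x : A) * a‖ := rfl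
        _ ≤ ‖(x : A)‖ * ‖a‖ := norm_mul_le _ _
        _ = ‖x‖ * ‖a‖ := by rw [Submodule.coe_norm]
        _ = ‖a‖ * ‖x‖ := mul_comm _ _)

@[simp] lemma lAct_apply (a : A) (x : ↥I.car) : (I.lAct a x : A) = a * (x : A) := rfl
@[simp] lemma rAct_apply (a : A) (x : ↥I.car) : (I.rAct a x : A) = (x : A) * a := rfl

/-- A closed two-sided ideal as a Banach `A`-bimodule. -/
def toBMod : BMod A where
  X := ↥I.car
  act :=
    { l := I.lAct
      r := I.rAct
      l_mul := fun a b x => Subtype.ext <| by simp [mul_assoc]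
      r_mul := fun a b x => Subtype.ext <| by simp [mul_assoc]
      lr := fun a b x => Subtype.ext <| by simp [mul_assoc] }

end ClosedIdeal

/-- The Banach algebra `A` as a Banach bimodule over itself. -/
def regBMod (A : Type u) [NonUnitalNormedRing A] [NormedSpace ℂ A]
    [SMulCommClass ℂ A A] [IsScalarTower ℂ A A] : BMod A where
  X := A
  act :=
    { l := ContinuousLinearMap.mul ℂ A
      r := (ContinuousLinearMap.mul ℂ A).flip
      l_mul := fun a b x => by simp [mul_assoc]
      r_mul := fun a b x => by simp [mul_assoc]
      lr := fun a b x => by simp [mul_assoc] }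

/-- `A` is `n`-`I`-weakly amenable: `H¹(A, I⁽ⁿ⁾) = {0}`. -/
def NIWeaklyAmenable (I : ClosedIdeal A) (n : ℕ) : Prop :=
  H1Zero (I.toBMod.iter n)

/-- `A` is `n`-ideally amenable. -/
def NIdeallyAmenable (A : Type u) [NonUnitalNormedRing A] [NormedSpace ℂ A]
    [SMulCommClass ℂ A A] [IsScalarTower ℂ A A] (n : ℕ) : Prop :=
  ∀ I : ClosedIdeal A, H1Zero (I.toBMod.iter n)

/-- `A` is `n`-weakly amenable: `H¹(A, A⁽ⁿ⁾) = {0}`. -/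
def NWeaklyAmenable (A : Type u) [NonUnitalNormedRing A] [NormedSpace ℂ A]
    [SMulCommClass ℂ A A] [IsScalarTower ℂ A A] (n : ℕ) : Prop :=
  H1Zero ((regBMod A).iter n)

/- ## Arens-type extensions of bounded bilinear maps to biduals -/

section Arens

variable {E F G : Type*}
  [SeminormedAddCommGroup E] [NormedSpace ℂ E]
  [SeminormedAddCommGroup F] [NormedSpace ℂ F]
  [SeminormedAddCommGroup G] [NormedSpace ℂ G]

/-- Auxiliary map for the Arens extension:
`arT b Ψ g = (e ↦ Ψ (g ∘ b e))`. -/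
def arT (b : E →L[ℂ] F →L[ℂ] G) (Ψ : Dl (Dl F)) (g : Dl G) : Dl E :=
  LinearMap.mkContinuous
    { toFun := fun e => Ψ (g.comp (b e))
      map_add' := fun e e' => by simp only [map_add, ContinuousLinearMap.comp_add, map_add]
      map_smul' := fun c e => by
        simp only [map_smul, ContinuousLinearMap.comp_smul, map_smul, RingHom.id_apply] }
    (‖Ψ‖ * ‖g‖ * ‖b‖)
    (fun e => by
      calc ‖Ψ (g.comp (b e))‖ ≤ ‖Ψ‖ * ‖g.comp (b e)‖ := Ψ.le_opNorm _
        _ ≤ ‖Ψ‖ * (‖g‖ * ‖b e‖) := by gcongr; exact g.opNorm_comp_le _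
        _ ≤ ‖Ψ‖ * (‖g‖ * (‖b‖ * ‖e‖)) := by gcongr; exact b.le_opNorm e
        _ = ‖Ψ‖ * ‖g‖ * ‖b‖ * ‖e‖ := by ring)

@[simp] lemma arT_apply (b : E →L[ℂ] F →L[ℂ] G) (Ψ : Dl (Dl F)) (g : Dl G)
    (e : E) : arT b Ψ g e = Ψ (g.comp (b e)) := rfl

lemma arT_add_right (b : E →L[ℂ] F →L[ℂ] G) (Ψ Ψ' : Dl (Dl F)) (g : Dl G) :
    arT b (Ψ + Ψ') g = arT b Ψ g + arT b Ψ' g := by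
  ext e; simp

lemma arT_smul_right (b : E →L[ℂ] F →L[ℂ] G) (c : ℂ) (Ψ : Dl (Dl F)) (g : Dl G) :
    arT b (c • Ψ) g = c • arT b Ψ g := by
  ext e; simp

lemma arT_add_g (b : E →L[ℂ] F →L[ℂ] G) (Ψ : Dl (Dl F)) (g g' : Dl G) :
    arT b Ψ (g + g') = arT b Ψ g + arT b Ψ g' := by
  ext e; simp [ContinuousLinearMap.add_comp]

lemma arT_smul_g (b : E →L[ℂ] F →L[ℂ] G) (c : ℂ) (Ψ : Dl (Dl F)) (g : Dl G) :
    arT b Ψ (c • g) = c • arT b Ψ g := by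
  ext e; simp [ContinuousLinearMap.smul_comp]

/-- One half of the Arens extension: `(arExtFun b Φ Ψ) g = Φ (e ↦ Ψ (g ∘ b e))`. -/
def arExtFun (b : E →L[ℂ] F →L[ℂ] G) (Φ : Dl (Dl E)) (Ψ : Dl (Dl F)) :
    Dl (Dl G) :=
  LinearMap.mkContinuous
    { toFun := fun g => Φ (arT b Ψ g)
      map_add' := fun g g' => by simp only [arT_add_g, map_add]
      map_smul' := fun c g => by simp only [arT_smul_g, map_smul, RingHom.id_apply] }
    (‖Φ‖ * ‖Ψ‖ * ‖b‖)
    (fun g => by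
      calc ‖Φ (arT b Ψ g)‖ ≤ ‖Φ‖ * ‖arT b Ψ g‖ := Φ.le_opNorm _
        _ ≤ ‖Φ‖ * (‖Ψ‖ * ‖g‖ * ‖b‖) := by
            gcongr
            exact LinearMap.mkContinuous_norm_le _ (by positivity) _
        _ = ‖Φ‖ * ‖Ψ‖ * ‖b‖ * ‖g‖ := by ring)

@[simp] lemma arExtFun_apply (b : E →L[ℂ] F →L[ℂ] G) (Φ : Dl (Dl E))
    (Ψ : Dl (Dl F)) (g : Dl G) : arExtFun b Φ Ψ g = Φ (arT b Ψ g) := rfl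

lemma arExtFun_norm_le (b : E →L[ℂ] F →L[ℂ] G) (Φ : Dl (Dl E))
    (Ψ : Dl (Dl F)) : ‖arExtFun b Φ Ψ‖ ≤ ‖Φ‖ * ‖Ψ‖ * ‖b‖ :=
  LinearMap.mkContinuous_norm_le _ (by positivity) _

/-- The (first-)Arens-type extension of a bounded bilinear map `b : E × F → G` to the
biduals, obtained by iterated weak* limits (outer limit in the first variable):
`(arExt b Φ Ψ) g = Φ (e ↦ Ψ (g ∘ b e))`. -/
def arExt (b : E →L[ℂ] F →L[ℂ] G) :
    Dl (Dl E) →L[ℂ] Dl (Dl F) →L[ℂ] Dl (Dl G) :=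
  LinearMap.mkContinuous₂
    (LinearMap.mk₂ ℂ (arExtFun b)
      (fun Φ Φ' Ψ => by ext g; simp)
      (fun c Φ Ψ => by ext g; simp)
      (fun Φ Ψ Ψ' => by ext g; simp [arT_add_right])
      (fun c Φ Ψ => by ext g; simp [arT_smul_right]))
    ‖b‖
    (fun Φ Ψ => by
      simp only [LinearMap.mk₂_apply]
      exact (arExtFun_norm_le b Φ Ψ).trans (le_of_eq (by ring)))

@[simp] lemma arExt_apply (b : E →L[ℂ] F →L[ℂ] G) (Φ : Dl (Dl E))
    (Ψ : Dl (Dl F)) (g : Dl G) : arExt b Φ Ψ g = Φ (arT b Ψ g) := rfl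

end Arens

/- ## Arens products and Arens module extensions -/

/-- The first Arens product on the bidual of a Banach algebra. -/
def arensMul (A : Type u) [NonUnitalNormedRing A] [NormedSpace ℂ A]
    [SMulCommClass ℂ A A] [IsScalarTower ℂ A A] :
    Dl (Dl A) →L[ℂ] Dl (Dl A) →L[ℂ] Dl (Dl A) :=
  arExt (ContinuousLinearMap.mul ℂ A)

/-- The second Arens product on the bidual of a Banach algebra. -/
def arensMul₂ (A : Type u) [NonUnitalNormedRing A] [NormedSpace ℂ A]
    [SMulCommClass ℂ A A] [IsScalarTower ℂ A A]
    (F G : Dl (Dl A)) : Dl (Dl A) :=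
  arExt (ContinuousLinearMap.mul ℂ A).flip G F

namespace Bimodule

variable {X : Type u} [NormedAddCommGroup X] [NormedSpace ℂ X]

/-- First (iterated weak*-limit) extension of the left action:
`a'' · x'' = w*-lim_i lim_j a_i • x_j`. -/
def lExt (M : Bimodule A X) (F : Dl (Dl A)) (ξ : Dl (Dl X)) :
    Dl (Dl X) :=
  arExt M.l F ξ

/-- Second extension of the left action: `a'' · x'' = w*-lim_j lim_i a_i • x_j`. -/
def lExt₂ (M : Bimodule A X) (F : Dl (Dl A)) (ξ : Dl (Dl X)) :
    Dl (Dl X) :=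
  arExt M.l.flip ξ F

/-- First (iterated weak*-limit) extension of the right action:
`x'' · a'' = w*-lim_j lim_i x_j • a_i`. -/
def rExt (M : Bimodule A X) (ξ : Dl (Dl X)) (F : Dl (Dl A)) :
    Dl (Dl X) :=
  arExt M.r.flip ξ F

/-- Second extension of the right action: `x'' · a'' = w*-lim_i lim_j x_j • a_i`. -/
def rExt₂ (M : Bimodule A X) (ξ : Dl (Dl X)) (F : Dl (Dl A)) :
    Dl (Dl X) :=
  arExt M.r F ξ

/-- The topological centre of the right module action of `A` on `X`, i.e. the set of
`x'' ∈ X**` such that `a'' ↦ x'' · a''` is weak*-weak* continuous. -/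
def rTopCenter (M : Bimodule A X) : Set (Dl (Dl X)) :=
  {ξ | Continuous fun F : WeakDual ℂ (Dl A) => (M.rExt ξ F : WeakDual ℂ (Dl X))}

end Bimodule

/-- The topological centre of the bidual of a Banach algebra (with the first
Arens product): the set of `F ∈ A**` for which `G ↦ F □ G` is weak*-weak* continuous. -/
def arensTopCenter (A : Type u) [NonUnitalNormedRing A] [NormedSpace ℂ A]
    [SMulCommClass ℂ A A] [IsScalarTower ℂ A A] : Set (Dl (Dl A)) :=
  {F | Continuous fun G : WeakDual ℂ (Dl A) => (arensMul A F G : WeakDual ℂ (Dl A))}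

/- ## Adjoint maps -/

section DMap

variable {E F : Type*} [SeminormedAddCommGroup E] [NormedSpace ℂ E]
  [SeminormedAddCommGroup F] [NormedSpace ℂ F]

/-- The adjoint (dual map) of a bounded operator. -/
def dMap (f : E →L[ℂ] F) : Dl F →L[ℂ] Dl E :=
  (ContinuousLinearMap.compL ℂ E F ℂ).flip f

@[simp] lemma dMap_apply (f : E →L[ℂ] F) (g : Dl F) : dMap f g = g.comp f := rfl

/-- The canonical projection `X⁽⁴⁾ → X⁽²⁾`, i.e. the adjoint of the canonical
embedding `X* → X***`. -/
def Pmap (X : Type u) [SeminormedAddCommGroup X] [NormedSpace ℂ X] :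
    Dl (Dl (Dl (Dl X))) →L[ℂ] Dl (Dl X) :=
  dMap (inclDD (Dl X))

end DMap

/- ## The bidual of a Banach algebra as a Banach algebra under the first Arens product -/

set_option synthInstance.maxHeartbeats 800000
set_option maxHeartbeats 1600000

section ArensBidualAlgebra

variable (A : Type u) [NonUnitalNormedRing A] [NormedSpace ℂ A]
  [SMulCommClass ℂ A A] [IsScalarTower ℂ A A]

lemma comp_mulLeft (f : Dl A) (a b : A) :
    f.comp (ContinuousLinearMap.mul ℂ A (a * b)) =
      (f.comp (ContinuousLinearMap.mul ℂ A a)).comp (ContinuousLinearMap.mul ℂ A b) := by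
  ext c
  simp [mul_assoc]

lemma arT_comp_mulLeft (H : Dl (Dl A)) (f : Dl A) (a : A) :
    (arT (ContinuousLinearMap.mul ℂ A) H f).comp (ContinuousLinearMap.mul ℂ A a) =
      arT (ContinuousLinearMap.mul ℂ A) H (f.comp (ContinuousLinearMap.mul ℂ A a)) := by
  ext b
  simp [comp_mulLeft]

lemma arT_arensMul (G H : Dl (Dl A)) (f : Dl A) :
    arT (ContinuousLinearMap.mul ℂ A) G (arT (ContinuousLinearMap.mul ℂ A) H f) =
      arT (ContinuousLinearMap.mul ℂ A) (arensMul A G H) f := by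
  ext a
  simp [arT_comp_mulLeft, arensMul]

lemma arensMul_assoc (F G H : Dl (Dl A)) :
    arensMul A (arensMul A F G) H = arensMul A F (arensMul A G H) := by
  ext f
  calc arensMul A (arensMul A F G) H f
      = F (arT (ContinuousLinearMap.mul ℂ A) G (arT (ContinuousLinearMap.mul ℂ A) H f)) := rfl
    _ = F (arT (ContinuousLinearMap.mul ℂ A) (arensMul A G H) f) := by rw [arT_arensMul]
    _ = arensMul A F (arensMul A G H) f := rfl

lemma arensMul_norm_le (F G : Dl (Dl A)) : ‖arensMul A F G‖ ≤ ‖F‖ * ‖G‖ := by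
  have h1 : ‖arExtFun (ContinuousLinearMap.mul ℂ A) F G‖ ≤
      ‖F‖ * ‖G‖ * ‖ContinuousLinearMap.mul ℂ A‖ := arExtFun_norm_le _ _ _
  have h2 : ‖ContinuousLinearMap.mul ℂ A‖ ≤ 1 := ContinuousLinearMap.opNorm_mul_le ℂ A
  calc ‖arensMul A F G‖ = ‖arExtFun (ContinuousLinearMap.mul ℂ A) F G‖ := rfl
    _ ≤ ‖F‖ * ‖G‖ * ‖ContinuousLinearMap.mul ℂ A‖ := h1
    _ ≤ ‖F‖ * ‖G‖ * 1 := by gcongr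
    _ = ‖F‖ * ‖G‖ := mul_one _

/-- The bidual `A**` of a Banach algebra `A`, regarded as a Banach algebra
under the first Arens product. -/
def ArensBidual : Type u := Dl (Dl A)

namespace ArensBidual

noncomputable instance instNormedAddCommGroup : NormedAddCommGroup (ArensBidual A) :=
  inferInstanceAs (NormedAddCommGroup (Dl (Dl A)))

noncomputable instance instNormedSpace : NormedSpace ℂ (ArensBidual A) :=
  inferInstanceAs (NormedSpace ℂ (Dl (Dl A)))

/-- Interpret an element of `A**` as an element of the Arens algebra. -/
def of (F : Dl (Dl A)) : ArensBidual A := F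

variable {A}

noncomputable instance instMul : Mul (ArensBidual A) := ⟨fun F G => arensMul A F G⟩

lemma mul_def (F G : ArensBidual A) : F * G = arensMul A F G := rfl

noncomputable instance instNonUnitalNormedRing : NonUnitalNormedRing (ArensBidual A) :=
  { ArensBidual.instNormedAddCommGroup A with
    mul := (· * ·)
    left_distrib := fun F G H => (arensMul A F).map_add G H
    right_distrib := fun F G H => by
      show arensMul A (F + G) H = arensMul A F H + arensMul A G H
      exact DFunLike.congr_fun ((arensMul A).map_add F G) H
    zero_mul := fun F => by
      show arensMul A 0 F = 0
      rw [(arensMul A).map_zero]; rfl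
    mul_zero := fun F => (arensMul A F).map_zero
    mul_assoc := fun F G H => arensMul_assoc A F G H
    norm_mul_le := fun F G => arensMul_norm_le A F G }

noncomputable instance instIsScalarTower : IsScalarTower ℂ (ArensBidual A) (ArensBidual A) :=
  ⟨fun c F G => by
    show arensMul A (c • F) G = c • arensMul A F G
    exact DFunLike.congr_fun ((arensMul A).map_smul c F) G⟩

noncomputable instance instSMulCommClass : SMulCommClass ℂ (ArensBidual A) (ArensBidual A) :=
  ⟨fun c F G => by
    show c • arensMul A F G = arensMul A F (c • G)
    exact ((arensMul A F).map_smul c G).symm⟩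

end ArensBidual

end ArensBidualAlgebra


/-! ## The bidual of a closed ideal inside the bidual algebra -/

namespace ClosedIdeal

variable (I : ClosedIdeal A)

/-- The second adjoint of the inclusion `I → A`, as an isometric embedding `I** → A**`. -/
def bidualIncl : Dl (Dl ↥I.car) →ₗᵢ[ℂ] ArensBidual A where
  toLinearMap := (dMap (dMap I.car.subtypeL)).toLinearMap
  norm_map' Φ := by
    change ‖dMap (dMap I.car.subtypeL) Φ‖ = ‖Φ‖
    apply le_antisymm
    · refine ContinuousLinearMap.opNorm_le_bound _ (norm_nonneg _) fun f => ?_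
      refine (Φ.le_opNorm _).trans ?_
      gcongr
      refine ContinuousLinearMap.opNorm_le_bound _ (norm_nonneg _) fun x => ?_
      exact f.le_opNorm _
    · refine ContinuousLinearMap.opNorm_le_bound _ (norm_nonneg _) fun g => ?_
      obtain ⟨f, hf, hnorm⟩ := exists_extension_norm_eq I.car g
      have hfg : f.comp I.car.subtypeL = g := ContinuousLinearMap.ext hf
      rw [← hnorm]
      calc ‖Φ g‖ = ‖dMap (dMap I.car.subtypeL) Φ f‖ := by
            rw [dMap_apply, ContinuousLinearMap.comp_apply, dMap_apply, hfg]
        _ ≤ _ := ContinuousLinearMap.le_opNorm _ _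

lemma bidualIncl_injective : Function.Injective I.bidualIncl.toLinearMap := by
  intro Φ Ψ hΦΨ
  ext g
  obtain ⟨f, hf, -⟩ := exists_extension_norm_eq I.car g
  have hfg : f.comp I.car.subtypeL = g := ContinuousLinearMap.ext hf
  rw [← hfg]
  exact congrArg (fun Θ : Dl (Dl A) => Θ f) hΦΨ

lemma mul_bidualIncl (F : ArensBidual A) (Φ : Dl (Dl ↥I.car)) :
    F * I.bidualIncl Φ = I.bidualIncl (arExt I.lAct F Φ) := rfl

lemma bidualIncl_mul (hreg : ∀ F G : Dl (Dl A), arensMul A F G = arensMul₂ A F G)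
    (F : ArensBidual A) (Φ : Dl (Dl ↥I.car)) :
    I.bidualIncl Φ * F = I.bidualIncl (arExt I.rAct F Φ) :=
  hreg (I.bidualIncl Φ) F

/-- For an Arens regular algebra, the weak* continuous extension `A** → I**` of a derivation
`A → I**` satisfies the derivation identity for the extended actions. -/
lemma dMap_flip_arensMul (hreg : ∀ F G : Dl (Dl A), arensMul A F G = arensMul₂ A F G)
    (D : A →L[ℂ] Dl (Dl ↥I.car))
    (hD : ∀ a b g, D (a * b) g = D b (g.comp (I.lAct a)) + D a (g.comp (I.rAct b)))
    (F G : Dl (Dl A)) :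
    dMap D.flip (arensMul A F G) =
      arExt I.lAct F (dMap D.flip G) + arExt I.rAct G (dMap D.flip F) := by
  ext g
  obtain ⟨f, hf, -⟩ := exists_extension_norm_eq I.car g
  have hfg : f.comp I.car.subtypeL = g := ContinuousLinearMap.ext hf
  have hswap (Φ : Dl (Dl ↥I.car)) :
      Φ ((arT (ContinuousLinearMap.mul ℂ A) G f).comp I.car.subtypeL) =
        G (arT I.rAct Φ g) := by
    rw [← hfg]
    exact congrArg (fun Ψ : Dl (Dl A) => Ψ f) (I.bidualIncl_mul hreg G Φ)
  have hsum : arT (ContinuousLinearMap.mul ℂ A) G (D.flip g) =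
      arT I.lAct (dMap D.flip G) g +
        D.flip ((arT (ContinuousLinearMap.mul ℂ A) G f).comp I.car.subtypeL) := by
    ext a
    have hsplit : (D.flip g).comp (ContinuousLinearMap.mul ℂ A a) =
        D.flip (g.comp (I.lAct a)) + arT I.rAct (D a) g :=
      ContinuousLinearMap.ext fun b => hD a b g
    rw [arT_apply, hsplit, map_add, ← hswap]
    rfl
  calc dMap D.flip (arensMul A F G) g
      = F (arT (ContinuousLinearMap.mul ℂ A) G (D.flip g)) := rfl
    _ = F (arT I.lAct (dMap D.flip G) g) +
        dMap D.flip F ((arT (ContinuousLinearMap.mul ℂ A) G f).comp I.car.subtypeL) := by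
        rw [hsum, map_add]; rfl
    _ = _ := by rw [hswap]; rfl

/-- The copy of `I**` inside `A**`, a closed two-sided ideal when `A` is Arens regular. -/
def bidualIdeal (hreg : ∀ F G : Dl (Dl A), arensMul A F G = arensMul₂ A F G) :
    ClosedIdeal (ArensBidual A) where
  car := LinearMap.range I.bidualIncl.toLinearMap
  isClosed := by
    rw [LinearMap.coe_range]
    exact I.bidualIncl.isometry.antilipschitz.isClosed_range
      I.bidualIncl.isometry.uniformContinuous
  mul_mem_left := by
    rintro F _ ⟨Φ, rfl⟩
    exact ⟨_, (I.mul_bidualIncl F Φ).symm⟩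
  mul_mem_right := by
    rintro F _ ⟨Φ, rfl⟩
    exact ⟨_, (I.bidualIncl_mul hreg F Φ).symm⟩

variable (hreg : ∀ F G : Dl (Dl A), arensMul A F G = arensMul₂ A F G)

/-- The identification of `I**` with the ideal `bidualIdeal` of `A**`. -/
def bidualEquiv : Dl (Dl ↥I.car) ≃ₗᵢ[ℂ] ↥(I.bidualIdeal hreg).car :=
  { toLinearEquiv := LinearEquiv.ofInjective I.bidualIncl.toLinearMap I.bidualIncl_injective
    norm_map' := I.bidualIncl.norm_map }

lemma lAct_bidualEquiv (F : ArensBidual A) (Φ : Dl (Dl ↥I.car)) :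
    (I.bidualIdeal hreg).lAct F (I.bidualEquiv hreg Φ) =
      I.bidualEquiv hreg (arExt I.lAct F Φ) :=
  Subtype.ext (I.mul_bidualIncl F Φ)

lemma rAct_bidualEquiv (F : ArensBidual A) (Φ : Dl (Dl ↥I.car)) :
    (I.bidualIdeal hreg).rAct F (I.bidualEquiv hreg Φ) =
      I.bidualEquiv hreg (arExt I.rAct F Φ) :=
  Subtype.ext (I.bidualIncl_mul hreg F Φ)

/-- The embedding of `I*` into the dual of `bidualIdeal` as evaluation functionals. -/
def evalBidual : Dl ↥I.car →L[ℂ] Dl ↥(I.bidualIdeal hreg).car :=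
  ((I.bidualEquiv hreg).symm.toContinuousLinearEquiv.toContinuousLinearMap).flip

lemma evalBidual_bidualEquiv (g : Dl ↥I.car) (Φ : Dl (Dl ↥I.car)) :
    I.evalBidual hreg g (I.bidualEquiv hreg Φ) = Φ g :=
  congrArg (fun Ψ : Dl (Dl ↥I.car) => Ψ g) ((I.bidualEquiv hreg).symm_apply_apply Φ)

lemma evalBidual_comp_lAct (a : A) (g : Dl ↥I.car) :
    (I.evalBidual hreg g).comp ((I.bidualIdeal hreg).lAct (ArensBidual.of A (inclDD A a))) =
      I.evalBidual hreg (g.comp (I.lAct a)) := by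
  ext j
  obtain ⟨Φ, rfl⟩ := (I.bidualEquiv hreg).surjective j
  rw [ContinuousLinearMap.comp_apply, lAct_bidualEquiv, evalBidual_bidualEquiv,
    evalBidual_bidualEquiv]
  rfl

lemma evalBidual_comp_rAct (a : A) (g : Dl ↥I.car) :
    (I.evalBidual hreg g).comp ((I.bidualIdeal hreg).rAct (ArensBidual.of A (inclDD A a))) =
      I.evalBidual hreg (g.comp (I.rAct a)) := by
  ext j
  obtain ⟨Φ, rfl⟩ := (I.bidualEquiv hreg).surjective j
  rw [ContinuousLinearMap.comp_apply, rAct_bidualEquiv, evalBidual_bidualEquiv,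
    evalBidual_bidualEquiv]
  rfl

end ClosedIdeal

/-- **Corollary 1.4.** Let `A` be an Arens regular Banach algebra.  If
`H¹(A**, I**) = 0` for every closed two-sided ideal `I` of `A**` (with the first
Arens product), then `A` is `2`-ideally amenable. -/
theorem two_ideally_amenable_of_bidual_ideals
    {A : Type u} [NonUnitalNormedRing A] [NormedSpace ℂ A]
    [SMulCommClass ℂ A A] [IsScalarTower ℂ A A] [CompleteSpace A]
    (hreg : ∀ F G : Dl (Dl A), arensMul A F G = arensMul₂ A F G)
    (h : ∀ I : ClosedIdeal (ArensBidual A), H1Zero (I.toBMod.iter 2)) :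
    NIdeallyAmenable A 2 := by
  intro I D hD
  change A →L[ℂ] Dl (Dl ↥I.car) at D
  have hD' (a b : A) (g : Dl ↥I.car) :
      D (a * b) g = D b (g.comp (I.lAct a)) + D a (g.comp (I.rAct b)) :=
    congrArg (fun Ψ : Dl (Dl ↥I.car) => Ψ g) (hD a b)
  let J := I.bidualIdeal hreg
  let e := I.bidualEquiv hreg
  let δ : ArensBidual A →L[ℂ] ↥J.car :=
    e.toContinuousLinearEquiv.toContinuousLinearMap.comp (dMap D.flip)
  have hδ (F G : ArensBidual A) : δ (F * G) = J.lAct F (δ G) + J.rAct G (δ F) := by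
    refine (congrArg e (I.dMap_flip_arensMul hreg D hD' F G)).trans ?_
    rw [map_add]
    exact congrArg₂ (· + ·) (I.lAct_bidualEquiv hreg F _).symm (I.rAct_bidualEquiv hreg G _).symm
  obtain ⟨Ξ, hΞ⟩ := h J ((inclDD ↥J.car).comp δ) fun F G => by
    change inclDD ↥J.car (δ (F * G)) = _
    rw [hδ, map_add]
    rfl
  change Dl (Dl ↥J.car) at Ξ
  refine ⟨dMap (I.evalBidual hreg) Ξ, fun a => ContinuousLinearMap.ext fun (g : Dl ↥I.car) => ?_⟩
  have hval := congrArg (fun Ψ : Dl (Dl ↥J.car) => Ψ (I.evalBidual hreg g))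
    (hΞ (ArensBidual.of A (inclDD A a)))
  calc D a g = I.evalBidual hreg g (δ (ArensBidual.of A (inclDD A a))) :=
        (I.evalBidual_bidualEquiv hreg g _).symm
    _ = Ξ ((I.evalBidual hreg g).comp (J.lAct (ArensBidual.of A (inclDD A a)))) -
        Ξ ((I.evalBidual hreg g).comp (J.rAct (ArensBidual.of A (inclDD A a)))) := hval
    _ = Ξ (I.evalBidual hreg (g.comp (I.lAct a))) -
        Ξ (I.evalBidual hreg (g.comp (I.rAct a))) :=
        congrArg₂ (fun φ ψ => Ξ φ - Ξ ψ) (I.evalBidual_comp_lAct hreg a g)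
          (I.evalBidual_comp_rAct hreg a g)
    _ = _ := rfl
end
end

section
/- Let A be a Banach algebra and I a closed two-sided ideal of A which is unital (has an identity element as an algebra). Let J be a closed two-sided ideal of I, and let n ∈ ℕ. Then J is a closed two-sided ideal of A, and A is n-J-weakly amenable if and only if I is n-J-weakly amenable. -/
/- ## Core definitions: Banach bimodules over (non-unital) complex Banach algebras,
iterated dual modules, derivations, ideal amenability, and Arens extensions. -/

noncomputable section

open ContinuousLinearMap

universe u

variable {A : Type u} [NonUnitalNormedRing A] [NormedSpace ℂ A]
  [SMulCommClass ℂ A A] [IsScalarTower ℂ A A]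

/- ## A closed two-sided ideal as a Banach algebra in its own right -/

section IdealAlgebra

variable {A : Type u} [NonUnitalNormedRing A] [NormedSpace ℂ A]
  [SMulCommClass ℂ A A] [IsScalarTower ℂ A A]

instance ClosedIdeal.instMul (I : ClosedIdeal A) : Mul ↥I.car :=
  ⟨fun x y => ⟨(x : A) * (y : A), I.mul_mem_left (x : A) (y : A) y.2⟩⟩

@[simp] lemma ClosedIdeal.coe_mul (I : ClosedIdeal A) (x y : ↥I.car) :
    ((x * y : ↥I.car) : A) = (x : A) * (y : A) := rfl

noncomputable instance ClosedIdeal.instNonUnitalNormedRing (I : ClosedIdeal A) :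
    NonUnitalNormedRing ↥I.car :=
  { (inferInstance : NormedAddCommGroup ↥I.car) with
    mul := (· * ·)
    left_distrib := fun x y z => Subtype.ext <| by simp [mul_add]
    right_distrib := fun x y z => Subtype.ext <| by simp [add_mul]
    zero_mul := fun x => Subtype.ext <| by simp
    mul_zero := fun x => Subtype.ext <| by simp
    mul_assoc := fun x y z => Subtype.ext <| by simp [mul_assoc]
    norm_mul_le := fun x y => by
      rw [Submodule.coe_norm, Submodule.coe_norm, Submodule.coe_norm]
      exact norm_mul_le (x : A) (y : A) }

instance ClosedIdeal.instIsScalarTower (I : ClosedIdeal A) : IsScalarTower ℂ ↥I.car ↥I.car :=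
  ⟨fun c x y => Subtype.ext <| by
    change (c • (x : A)) * (y : A) = c • ((x : A) * (y : A))
    exact smul_mul_assoc c (x : A) (y : A)⟩

instance ClosedIdeal.instSMulCommClass (I : ClosedIdeal A) : SMulCommClass ℂ ↥I.car ↥I.car :=
  ⟨fun c x y => Subtype.ext <| by
    change c • ((x : A) * (y : A)) = (x : A) * (c • (y : A))
    exact (mul_smul_comm c (x : A) (y : A)).symm⟩

end IdealAlgebra


/-- A bimodule over `A` is intertwined with a bimodule over `B` along `φ : A → B` when some
topological isomorphism identifies it with the pullback of the latter along `φ`. -/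
def IntertwinedAlong {B : Type u} [NonUnitalNormedRing B] [NormedSpace ℂ B]
    [SMulCommClass ℂ B B] [IsScalarTower ℂ B B] (φ : A →L[ℂ] B) (M : BMod A) (N : BMod B) :
    Prop :=
  ∃ T : M.X ≃L[ℂ] N.X, (∀ a x, T (M.act.l a x) = N.act.l (φ a) (T x)) ∧
    ∀ a x, T (M.act.r a x) = N.act.r (φ a) (T x)

/-- The element `e` acts as the identity on both sides of the bimodule `M`. -/
def ActsAsIdentity (M : BMod A) (e : A) : Prop :=
  ∀ x, M.act.l e x = x ∧ M.act.r e x = x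

theorem ActsAsIdentity.iter {M : BMod A} {e : A} (h : ActsAsIdentity M e) (n : ℕ) :
    ActsAsIdentity (M.iter n) e := by
  induction n with
  | zero => exact h
  | succ n ih =>
    intro (f : Dl (M.iter n).X)
    constructor
    · refine ContinuousLinearMap.ext fun x => ?_
      exact ((M.iter n).act.dualMod_l_apply e f x).trans (congrArg (⇑f) (ih x).2)
    · refine ContinuousLinearMap.ext fun x => ?_
      exact ((M.iter n).act.dualMod_r_apply e f x).trans (congrArg (⇑f) (ih x).1)

section Intertwined

variable {B : Type u} [NonUnitalNormedRing B] [NormedSpace ℂ B]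
  [SMulCommClass ℂ B B] [IsScalarTower ℂ B B] {φ : A →L[ℂ] B}

theorem IntertwinedAlong.dualObj {M : BMod A} {N : BMod B} (h : IntertwinedAlong φ M N) :
    IntertwinedAlong φ M.dualObj N.dualObj := by
  obtain ⟨T, hl, hr⟩ := h
  have hl' : ∀ a y, T.symm (N.act.l (φ a) y) = M.act.l a (T.symm y) := fun a y => by
    rw [T.symm_apply_eq, hl, T.apply_symm_apply]
  have hr' : ∀ a y, T.symm (N.act.r (φ a) y) = M.act.r a (T.symm y) := fun a y => by
    rw [T.symm_apply_eq, hr, T.apply_symm_apply]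
  refine ⟨T.arrowCongr (ContinuousLinearEquiv.refl ℂ ℂ), fun a (f : Dl M.X) => ?_,
    fun a (f : Dl M.X) => ?_⟩
  · refine ContinuousLinearMap.ext fun y => ?_
    refine (M.act.dualMod_l_apply a f (T.symm y)).trans ?_
    refine Eq.trans ?_ (N.act.dualMod_l_apply (φ a) _ y).symm
    exact congrArg (⇑f) (hr' a y).symm
  · refine ContinuousLinearMap.ext fun y => ?_
    refine (M.act.dualMod_r_apply a f (T.symm y)).trans ?_
    refine Eq.trans ?_ (N.act.dualMod_r_apply (φ a) _ y).symm
    exact congrArg (⇑f) (hl' a y).symm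

theorem IntertwinedAlong.iter {M : BMod A} {N : BMod B} (h : IntertwinedAlong φ M N) (n : ℕ) :
    IntertwinedAlong φ (M.iter n) (N.iter n) := by
  induction n with
  | zero => exact h
  | succ n ih => exact ih.dualObj

/-- A derivation into a bimodule on which an idempotent acts as the identity kills it. -/
theorem IsDerivation.map_eq_zero {M : BMod A} {D : A →L[ℂ] M.X} (hD : IsDerivation M D)
    {e : A} (he : e * e = e) (hM : ActsAsIdentity M e) : D e = 0 := by
  have h := hD e e
  rw [he, (hM _).1, (hM _).2] at h
  simpa using h

/-- Vanishing of first cohomology transfers along a multiplicative retraction `φ : A → B`,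
with multiplicative section `ι`, provided that `ι (φ a) = a * e` for an idempotent `e`
acting as the identity. -/
theorem IntertwinedAlong.h1Zero_iff {M : BMod A} {N : BMod B} (h : IntertwinedAlong φ M N)
    (ι : B →L[ℂ] A) {e : A} (hφ : ∀ a b, φ (a * b) = φ a * φ b)
    (hι : ∀ a b, ι (a * b) = ι a * ι b) (hφι : ∀ b, φ (ι b) = b)
    (hιφ : ∀ a, ι (φ a) = a * e) (he : e * e = e) (hN : ActsAsIdentity N (φ e)) :
    H1Zero M ↔ H1Zero N := by
  obtain ⟨T, hl, hr⟩ := h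
  have hM : ActsAsIdentity M e := fun x =>
    ⟨T.injective (by rw [hl, (hN _).1]), T.injective (by rw [hr, (hN _).2])⟩
  constructor
  · intro H D hD
    obtain ⟨x, hx⟩ := H ((T.symm : N.X →L[ℂ] M.X).comp (D.comp φ)) fun a b => by
      apply T.injective
      simp [hl, hr, hφ, hD (φ a) (φ b)]
    refine ⟨T x, fun b => ?_⟩
    have := congrArg T (hx (ι b))
    simpa [hl, hr, hφι] using this
  · intro H D hD
    obtain ⟨y, hy⟩ := H ((T : M.X →L[ℂ] N.X).comp (D.comp ι)) fun a b => by
      simp [hl, hr, hφι, hι, hD (ι a) (ι b)]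
    refine ⟨T.symm y, fun a => T.injective ?_⟩
    have hDa : D (ι (φ a)) = D a := by
      rw [hιφ, hD, hD.map_eq_zero he hM, (hM _).2, map_zero, zero_add]
    have := hy (φ a)
    simp only [ContinuousLinearMap.comp_apply, hDa] at this
    simpa [hl, hr] using this

end Intertwined

namespace ClosedIdeal

variable (I : ClosedIdeal A) {e : ↥I.car}

/-- The identity of a unital ideal is central in the ambient algebra. -/
theorem mul_unit_comm (he : ∀ x : ↥I.car, e * x = x ∧ x * e = x) (a : A) :
    a * (e : A) = (e : A) * a := by
  have h₁ := congrArg Subtype.val (he ⟨a * e, I.mul_mem_left a e e.2⟩).1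
  have h₂ := congrArg Subtype.val (he ⟨e * a, I.mul_mem_right a e e.2⟩).2
  simp only [coe_mul] at h₁ h₂
  rw [← h₁, ← mul_assoc, h₂]

theorem unit_mul_coe (he : ∀ x : ↥I.car, e * x = x ∧ x * e = x) (x : ↥I.car) :
    (e : A) * x = x :=
  congrArg Subtype.val (he x).1

theorem coe_mul_unit (he : ∀ x : ↥I.car, e * x = x ∧ x * e = x) (x : ↥I.car) :
    (x : A) * e = x :=
  congrArg Subtype.val (he x).2

/-- A closed ideal of a unital closed ideal, as a closed ideal of the ambient algebra. -/
def ofUnitalIdeal (he : ∀ x : ↥I.car, e * x = x ∧ x * e = x) (J : ClosedIdeal ↥I.car) :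
    ClosedIdeal A where
  car := J.car.map I.car.subtype
  isClosed := by
    rw [Submodule.map_coe]
    exact I.isClosed.isClosedEmbedding_subtypeVal.isClosedMap _ J.isClosed
  mul_mem_left := by
    rintro a _ ⟨x, hx, rfl⟩
    refine ⟨I.lAct a e * x, J.mul_mem_left _ _ hx, ?_⟩
    simp [mul_assoc, I.unit_mul_coe he]
  mul_mem_right := by
    rintro a _ ⟨x, hx, rfl⟩
    refine ⟨x * I.rAct a e, J.mul_mem_right _ _ hx, ?_⟩
    simp [← mul_assoc, I.coe_mul_unit he]

theorem mem_iff_of_coe_eq_image {K : ClosedIdeal A} {J : ClosedIdeal ↥I.car}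
    (h : (K.car : Set A) = Subtype.val '' (J.car : Set ↥I.car)) (x : ↥I.car) :
    (x : A) ∈ K.car ↔ x ∈ J.car := by
  rw [← SetLike.mem_coe, h, Subtype.val_injective.mem_set_image, SetLike.mem_coe]

theorem le_of_coe_eq_image {K : ClosedIdeal A} {J : ClosedIdeal ↥I.car}
    (h : (K.car : Set A) = Subtype.val '' (J.car : Set ↥I.car)) : K.car ≤ I.car := by
  intro x hx
  rw [← SetLike.mem_coe, h] at hx
  obtain ⟨y, -, rfl⟩ := hx
  exact y.2

/-- The identification of an ideal of `I` with its image in the ambient algebra. -/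
def equivOfCoeEqImage {K : ClosedIdeal A} {J : ClosedIdeal ↥I.car}
    (h : (K.car : Set A) = Subtype.val '' (J.car : Set ↥I.car)) : ↥K.car ≃ₗᵢ[ℂ] ↥J.car where
  toFun x := ⟨⟨x, I.le_of_coe_eq_image h x.2⟩, (I.mem_iff_of_coe_eq_image h _).1 x.2⟩
  invFun y := ⟨(y : ↥I.car), (I.mem_iff_of_coe_eq_image h _).2 y.2⟩
  left_inv _ := rfl
  right_inv _ := rfl
  map_add' _ _ := rfl
  map_smul' _ _ := rfl
  norm_map' _ := rfl

theorem intertwinedAlong_toBMod (he : ∀ x : ↥I.car, e * x = x ∧ x * e = x)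
    {K : ClosedIdeal A} {J : ClosedIdeal ↥I.car}
    (h : (K.car : Set A) = Subtype.val '' (J.car : Set ↥I.car)) :
    IntertwinedAlong (I.lAct.flip e) K.toBMod J.toBMod := by
  refine ⟨(I.equivOfCoeEqImage h).toContinuousLinearEquiv, fun a (x : ↥K.car) => ?_,
    fun a (x : ↥K.car) => ?_⟩
  · refine Subtype.ext (Subtype.ext ?_)
    change a * (x : A) = a * (e : A) * (x : A)
    rw [mul_assoc, I.unit_mul_coe he ⟨x, I.le_of_coe_eq_image h x.2⟩]
  · refine Subtype.ext (Subtype.ext ?_)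
    change (x : A) * a = (x : A) * (a * (e : A))
    rw [I.mul_unit_comm he, ← mul_assoc, I.coe_mul_unit he ⟨x, I.le_of_coe_eq_image h x.2⟩]

end ClosedIdeal

/-- **Theorem 1.9.** Let `I` be a closed two-sided ideal of `A` with a unit element,
and let `J` be a closed two-sided ideal of `I`.  Then `J` is a closed two-sided
ideal of `A`, and `A` is `n-J`-weakly amenable iff `I` is `n-J`-weakly amenable. -/
theorem ideal_of_unital_ideal
    {A : Type u} [NonUnitalNormedRing A] [NormedSpace ℂ A]
    [SMulCommClass ℂ A A] [IsScalarTower ℂ A A] [CompleteSpace A]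
    (I : ClosedIdeal A)
    (hunit : ∃ e : ↥I.car, ∀ x : ↥I.car, e * x = x ∧ x * e = x)
    (J : ClosedIdeal (↥I.car)) (n : ℕ) (hn : 1 ≤ n) :
    (∃ K : ClosedIdeal A, (K.car : Set A) = Subtype.val '' (J.car : Set ↥I.car)) ∧
    (∀ K : ClosedIdeal A, (K.car : Set A) = Subtype.val '' (J.car : Set ↥I.car) →
      (H1Zero (K.toBMod.iter n) ↔ H1Zero (J.toBMod.iter n))) := by
  obtain ⟨e, he⟩ := hunit
  refine ⟨⟨I.ofUnitalIdeal he J, rfl⟩, fun K hK => ?_⟩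
  have hJ : ActsAsIdentity J.toBMod e := fun (x : ↥J.car) =>
    ⟨Subtype.ext (he (x : ↥I.car)).1, Subtype.ext (he (x : ↥I.car)).2⟩
  have hee : I.lAct.flip e (e : A) = e := (he e).1
  refine ((I.intertwinedAlong_toBMod he hK).iter n).h1Zero_iff I.car.subtypeL (e := (e : A))
    (fun a b => Subtype.ext ?_) (fun _ _ => rfl) (fun x => (he x).2) (fun _ => rfl)
    (I.unit_mul_coe he e) (hee.symm ▸ hJ.iter n)
  change a * b * (e : A) = a * e * (b * e)
  rw [mul_assoc, mul_assoc a, ← I.lAct_apply b, I.unit_mul_coe he]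
end
end

section
/- Let A be a Banach algebra with unitization A# = A ⊕ ℂ, and let n ∈ ℕ. If A# is n-ideally amenable, then A is n-ideally amenable. -/
/- ## Core definitions: Banach bimodules over (non-unital) complex Banach algebras,
iterated dual modules, derivations, ideal amenability, and Arens extensions. -/

noncomputable section

open ContinuousLinearMap

universe u

variable {A : Type u} [NonUnitalNormedRing A] [NormedSpace ℂ A]
  [SMulCommClass ℂ A A] [IsScalarTower ℂ A A]

/- ## The unitization `A ⊕ ℂ` with the norm `‖(a, α)‖ = ‖a‖ + |α|` -/

set_option synthInstance.maxHeartbeats 400000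
set_option maxHeartbeats 1600000

section UnitizationL1

variable (A : Type u) [NonUnitalNormedRing A] [NormedSpace ℂ A]
  [SMulCommClass ℂ A A] [IsScalarTower ℂ A A]

/-- The unitization `A# = A ⊕ ℂ` of a Banach algebra `A` with product
`(a, α)(b, β) = (ab + αb + βa, αβ)` and norm `‖(a, α)‖ = ‖a‖ + |α|`. -/
def UnitizL1 : Type u := Unitization ℂ A

namespace UnitizL1

instance instRing : Ring (UnitizL1 A) := inferInstanceAs (Ring (Unitization ℂ A))

instance instAlgebra : Algebra ℂ (UnitizL1 A) := inferInstanceAs (Algebra ℂ (Unitization ℂ A))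

/-- Interpret an element of the unitization. -/
def toU (x : UnitizL1 A) : Unitization ℂ A := x

/-- The ℓ¹-norm on the unitization. -/
noncomputable def l1Norm : AddGroupNorm (UnitizL1 A) where
  toFun x := ‖(toU A x).snd‖ + ‖(toU A x).fst‖
  map_zero' := by
    have h1 : (toU A 0).snd = 0 := rfl
    have h2 : (toU A 0).fst = 0 := rfl
    rw [h1, h2, norm_zero, norm_zero, add_zero]
  add_le' := fun x y => by
    have h1 : ‖(toU A (x + y)).snd‖ ≤ ‖(toU A x).snd‖ + ‖(toU A y).snd‖ := by
      simp only [toU, Unitization.snd_add]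
      exact norm_add_le _ _
    have h2 : ‖(toU A (x + y)).fst‖ ≤ ‖(toU A x).fst‖ + ‖(toU A y).fst‖ := by
      simp only [toU, Unitization.fst_add]
      exact norm_add_le _ _
    linarith
  neg' := fun x => by
    have h1 : (toU A (-x)).snd = -(toU A x).snd := rfl
    have h2 : (toU A (-x)).fst = -(toU A x).fst := rfl
    rw [h1, h2, norm_neg, norm_neg]
  eq_zero_of_map_eq_zero' := fun x h => by
    have h0 : ‖(toU A x).snd‖ + ‖(toU A x).fst‖ = 0 := h
    have h1 : ‖(toU A x).snd‖ = 0 ∧ ‖(toU A x).fst‖ = 0 := by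
      constructor <;> nlinarith [norm_nonneg (toU A x).snd, norm_nonneg (toU A x).fst]
    have h2 : (toU A x).snd = 0 := norm_eq_zero.mp h1.1
    have h3 : (toU A x).fst = 0 := norm_eq_zero.mp h1.2
    show x = 0
    exact Unitization.ext h3 h2

noncomputable instance instNormedAddCommGroup : NormedAddCommGroup (UnitizL1 A) :=
  (l1Norm A).toNormedAddCommGroup

lemma norm_def (x : UnitizL1 A) : ‖x‖ = ‖(toU A x).snd‖ + ‖(toU A x).fst‖ := rfl

noncomputable instance instNormedRing : NormedRing (UnitizL1 A) :=
  { instNormedAddCommGroup A, instRing A with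
    norm_mul_le := fun x y => by
      rw [norm_def, norm_def, norm_def]
      have hfst : (toU A (x * y)).fst = (toU A x).fst * (toU A y).fst := rfl
      have hsnd : (toU A (x * y)).snd =
          (toU A x).fst • (toU A y).snd + (toU A y).fst • (toU A x).snd +
            (toU A x).snd * (toU A y).snd := rfl
      rw [hfst, hsnd]
      have h1 : ‖(toU A x).fst * (toU A y).fst‖ = ‖(toU A x).fst‖ * ‖(toU A y).fst‖ :=
        norm_mul _ _
      have h2 : ‖(toU A x).fst • (toU A y).snd + (toU A y).fst • (toU A x).snd +
          (toU A x).snd * (toU A y).snd‖ ≤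
          ‖(toU A x).fst‖ * ‖(toU A y).snd‖ + ‖(toU A y).fst‖ * ‖(toU A x).snd‖ +
            ‖(toU A x).snd‖ * ‖(toU A y).snd‖ := by
        refine (norm_add_le _ _).trans ?_
        have h3 := norm_add_le ((toU A x).fst • (toU A y).snd) ((toU A y).fst • (toU A x).snd)
        have h4 : ‖(toU A x).fst • (toU A y).snd‖ = ‖(toU A x).fst‖ * ‖(toU A y).snd‖ :=
          norm_smul _ _
        have h5 : ‖(toU A y).fst • (toU A x).snd‖ = ‖(toU A y).fst‖ * ‖(toU A x).snd‖ :=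
          norm_smul _ _
        have h6 : ‖(toU A x).snd * (toU A y).snd‖ ≤ ‖(toU A x).snd‖ * ‖(toU A y).snd‖ :=
          norm_mul_le _ _
        linarith
      rw [h1]
      nlinarith [norm_nonneg (toU A x).fst, norm_nonneg (toU A y).fst,
        norm_nonneg (toU A x).snd, norm_nonneg (toU A y).snd] }

noncomputable instance instNormedSpace : NormedSpace ℂ (UnitizL1 A) where
  norm_smul_le c x := by
    rw [norm_def, norm_def]
    have hs : (toU A (c • x)).snd = c • (toU A x).snd := rfl
    have hf : (toU A (c • x)).fst = c • (toU A x).fst := rfl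
    rw [hs, hf, norm_smul, norm_smul]
    ring_nf
    exact le_refl _

end UnitizL1

end UnitizationL1


namespace UnitizL1

variable (A : Type u) [NonUnitalNormedRing A] [NormedSpace ℂ A]
  [SMulCommClass ℂ A A] [IsScalarTower ℂ A A]

/-- The projection of the unitization onto the algebra, as a bounded operator. -/
def sndL : UnitizL1 A →L[ℂ] A :=
  LinearMap.mkContinuous
    { toFun := fun x => (toU A x).snd
      map_add' := fun _ _ => rfl
      map_smul' := fun _ _ => rfl }
    1 (fun x => by
      rw [one_mul, norm_def]
      exact le_add_of_nonneg_right (norm_nonneg _))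

/-- The projection of the unitization onto the scalars, as a bounded operator. -/
def fstL : UnitizL1 A →L[ℂ] ℂ :=
  LinearMap.mkContinuous
    { toFun := fun x => (toU A x).fst
      map_add' := fun _ _ => rfl
      map_smul' := fun _ _ => rfl }
    1 (fun x => by
      rw [one_mul, norm_def]
      exact le_add_of_nonneg_left (norm_nonneg _))

/-- The inclusion of the algebra into its unitization, as a bounded operator. -/
def inrL : A →L[ℂ] UnitizL1 A :=
  LinearMap.mkContinuous
    { toFun := fun a => (Unitization.inr a : Unitization ℂ A)
      map_add' := fun a b => Unitization.inr_add ℂ a b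
      map_smul' := fun c a => Unitization.inr_smul ℂ c a }
    1 (fun a => by
      have h : ‖(0 : ℂ)‖ = 0 := norm_zero
      rw [one_mul, norm_def]
      exact (add_eq_left.mpr h).le)

variable {A}

lemma ext {x y : UnitizL1 A} (h₁ : fstL A x = fstL A y) (h₂ : sndL A x = sndL A y) : x = y :=
  Unitization.ext h₁ h₂

@[simp] lemma fstL_inrL (a : A) : fstL A (inrL A a) = 0 := rfl

@[simp] lemma sndL_inrL (a : A) : sndL A (inrL A a) = a := rfl

@[simp] lemma fstL_mul (x y : UnitizL1 A) : fstL A (x * y) = fstL A x * fstL A y := rfl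

@[simp] lemma sndL_mul (x y : UnitizL1 A) :
    sndL A (x * y) = fstL A x • sndL A y + fstL A y • sndL A x + sndL A x * sndL A y := rfl

end UnitizL1

open UnitizL1

/-- A closed ideal of `A`, regarded as a closed ideal of the unitization of `A`. -/
def ClosedIdeal.unitiz (I : ClosedIdeal A) : ClosedIdeal (UnitizL1 A) where
  car := (fstL A).toLinearMap.ker ⊓ I.car.comap (sndL A).toLinearMap
  isClosed := (fstL A).isClosed_ker.inter (I.isClosed.preimage (sndL A).continuous)
  mul_mem_left := by
    rintro a x ⟨hx, hx'⟩
    have h : fstL A x = 0 := hx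
    refine ⟨show fstL A (a * x) = 0 by simp [h], show sndL A (a * x) ∈ I.car from ?_⟩
    rw [sndL_mul, h, zero_smul, add_zero]
    exact add_mem (I.car.smul_mem _ hx') (I.mul_mem_left _ _ hx')
  mul_mem_right := by
    rintro a x ⟨hx, hx'⟩
    have h : fstL A x = 0 := hx
    refine ⟨show fstL A (x * a) = 0 by simp [h], show sndL A (x * a) ∈ I.car from ?_⟩
    rw [sndL_mul, h, zero_smul, zero_add]
    exact add_mem (I.car.smul_mem _ hx') (I.mul_mem_right _ _ hx')

/-- A closed ideal of `A` is isomorphic, as a Banach space, to its copy in the unitization. -/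
def ClosedIdeal.unitizEquiv (I : ClosedIdeal A) : I.car ≃L[ℂ] I.unitiz.car :=
  ContinuousLinearEquiv.equivOfInverse
    (((inrL A).comp I.car.subtypeL).codRestrict I.unitiz.car fun x => ⟨fstL_inrL _, x.2⟩)
    (((sndL A).comp I.unitiz.car.subtypeL).codRestrict I.car fun x => x.2.2)
    (fun _ => rfl)
    (fun x => Subtype.ext <| UnitizL1.ext (show 0 = fstL A x from Eq.symm x.2.1) rfl)

/-- The `UnitizL1 A`-bimodule `N` is isomorphic to the unital extension of the
`A`-bimodule `M`, that is, to `M` with `(a, α) · m = a · m + α m` and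
`m · (a, α) = m · a + α m`. -/
def IsUnitalExtension (M : BMod A) (N : BMod (UnitizL1 A)) : Prop :=
  ∃ e : M.X ≃L[ℂ] N.X,
    (∀ x m, N.act.l x (e m) = e (M.act.l (sndL A x) m) + fstL A x • e m) ∧
    (∀ x m, N.act.r x (e m) = e (M.act.r (sndL A x) m) + fstL A x • e m)

lemma ClosedIdeal.isUnitalExtension (I : ClosedIdeal A) :
    IsUnitalExtension I.toBMod I.unitiz.toBMod := by
  refine ⟨I.unitizEquiv, fun x (m : I.car) => Subtype.ext ?_,
    fun x (m : I.car) => Subtype.ext ?_⟩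
  · change x * inrL A m = inrL A (sndL A x * m) + fstL A x • inrL A m
    exact UnitizL1.ext (by simp) (by simp [add_comm])
  · change inrL A m * x = inrL A (m * sndL A x) + fstL A x • inrL A m
    exact UnitizL1.ext (by simp) (by simp [add_comm])

namespace IsUnitalExtension

variable {M : BMod A} {N : BMod (UnitizL1 A)}

lemma dualObj (h : IsUnitalExtension M N) : IsUnitalExtension M.dualObj N.dualObj := by
  obtain ⟨e, hl, hr⟩ := h
  refine ⟨e.arrowCongr (ContinuousLinearEquiv.refl ℂ ℂ), fun x (f : Dl M.X) => ?_,
    fun x (f : Dl M.X) => ?_⟩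
  · refine ContinuousLinearMap.ext fun (y : N.X) => ?_
    obtain ⟨m, rfl⟩ := e.surjective y
    change f (e.symm (N.act.r x (e m))) =
      f (M.act.r (sndL A x) (e.symm (e m))) + fstL A x • f (e.symm (e m))
    simp [hr]
  · refine ContinuousLinearMap.ext fun (y : N.X) => ?_
    obtain ⟨m, rfl⟩ := e.surjective y
    change f (e.symm (N.act.l x (e m))) =
      f (M.act.l (sndL A x) (e.symm (e m))) + fstL A x • f (e.symm (e m))
    simp [hl]

lemma iter (h : IsUnitalExtension M N) (n : ℕ) : IsUnitalExtension (M.iter n) (N.iter n) := by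
  induction n with
  | zero => exact h
  | succ n ih => exact ih.dualObj

/-- A derivation into `M` extends to one into `N` that vanishes at the unit. -/
lemma h1Zero (h : IsUnitalExtension M N) (hN : H1Zero N) : H1Zero M := by
  obtain ⟨e, hl, hr⟩ := h
  intro D hD
  obtain ⟨y, hy⟩ := hN ((e : M.X →L[ℂ] N.X).comp (D.comp (sndL A))) fun a b => by
    simp only [ContinuousLinearMap.comp_apply, ContinuousLinearEquiv.coe_coe, sndL_mul,
      map_add, map_smul, hD (sndL A a) (sndL A b), hl, hr]
    abel
  obtain ⟨m, rfl⟩ := e.surjective y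
  refine ⟨m, fun a => e.injective ?_⟩
  simpa [hl, hr] using hy (inrL A a)

end IsUnitalExtension

/-- **Proposition 2.1(i).** If the unitization `A# = A ⊕ ℂ` is `n`-ideally amenable,
then `A` is `n`-ideally amenable. -/
theorem nIdeallyAmenable_of_unitization
    {A : Type u} [NonUnitalNormedRing A] [NormedSpace ℂ A]
    [SMulCommClass ℂ A A] [IsScalarTower ℂ A A] [CompleteSpace A]
    (n : ℕ) (hn : 1 ≤ n)
    (h : NIdeallyAmenable (UnitizL1 A) n) :
    NIdeallyAmenable A n := by
  exact fun I => (I.isUnitalExtension.iter n).h1Zero (h I.unitiz)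
end
end
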